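/- arXiv:1903.00311 — 2 statements merged into one kernel-verified Lean document; each statement's English description precedes it below -/
import Mathlib

section
/- Let ω ∈ (0,1) be irrational, let δ > 0, and set Δ = (1+ω)δ. Then Σ_{(q,p) ∈ Brjuno} e^{−(|q|+|p|)δ}/|qω − p| ≤ 2 ( 2 e^δ Σ_{k=0}^∞ e^{−q_k Δ} q_{k+1} + e^δ Σ_{k=0}^∞ e^{−2 q_k Δ} q_{k+1} log a_{k+1} ), as an inequality in [0,∞]. -/
open Real
open scoped ENNReal Classical

noncomputable section

def cfX (ω : ℝ) : ℕ → ℝ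
  | 0 => ω
  | n + 1 => Int.fract (cfX ω n)⁻¹

def cfA (ω : ℝ) : ℕ → ℕ
  | 0 => 0
  | n + 1 => (⌊(cfX ω n)⁻¹⌋).toNat

def cfQ (ω : ℝ) : ℕ → ℕ
  | 0 => 1
  | 1 => cfA ω 1
  | n + 2 => cfA ω (n + 2) * cfQ ω (n + 1) + cfQ ω n

def cfP (ω : ℝ) : ℕ → ℕ
  | 0 => 0
  | 1 => 1
  | n + 2 => cfA ω (n + 2) * cfP ω (n + 1) + cfP ω n

/-- `a*_{k+1}`: `⌊√((a_{k+1}+2)/2)⌋`, decremented by one if `√((a_{k+1}+2)/2)` is an integer. -/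
def aStar (ω : ℝ) (k : ℕ) : ℕ :=
  if ∃ m : ℕ, cfA ω (k + 1) + 2 = 2 * m ^ 2 then
    (⌊Real.sqrt (((cfA ω (k + 1) : ℝ) + 2) / 2)⌋).toNat - 1
  else (⌊Real.sqrt (((cfA ω (k + 1) : ℝ) + 2) / 2)⌋).toNat

/-- The set `Brjuno⁺` of indices `(q,p) = (a q_k, a p_k)`, `1 ≤ a ≤ a*_{k+1}`. -/
def BrjunoPlus (ω : ℝ) : Set (ℤ × ℤ) :=
  {qp | ∃ (k : ℕ) (a : ℕ), 1 ≤ a ∧ a ≤ aStar ω k ∧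
    qp.1 = (a : ℤ) * (cfQ ω k : ℤ) ∧ qp.2 = (a : ℤ) * (cfP ω k : ℤ)}

/-- `Brjuno = Brjuno⁺ ∪ (−Brjuno⁺)`. -/
def BrjunoSet (ω : ℝ) : Set (ℤ × ℤ) := BrjunoPlus ω ∪ {qp | -qp ∈ BrjunoPlus ω}

/-- `ConstType`: indices in the critical strip which are not Brjuno indices. -/
def ConstTypeSet (ω : ℝ) : Set (ℤ × ℤ) :=
  {qp | qp ≠ (0, 0) ∧ |(qp.1 : ℝ) * ω - (qp.2 : ℝ)| < 1} \ BrjunoSet ω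

end

theorem irrational_cfX {ω : ℝ} (hω : Irrational ω) (n : ℕ) : Irrational (cfX ω n) := by
  induction n with
  | zero => exact hω
  | succ n ih => exact (irrational_inv_iff.2 ih).sub_intCast _

theorem cfX_mem_Ioo {ω : ℝ} (hω : Irrational ω) (h0 : 0 < ω) (h1 : ω < 1) (n : ℕ) :
    0 < cfX ω n ∧ cfX ω n < 1 := by
  cases n with
  | zero => exact ⟨h0, h1⟩
  | succ n =>
    exact ⟨lt_of_le_of_ne (Int.fract_nonneg _) (irrational_cfX hω (n + 1)).ne_zero.symm,
      Int.fract_lt_one _⟩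

theorem cfX_inv_eq {ω : ℝ} (hω : Irrational ω) (h0 : 0 < ω) (h1 : ω < 1) (n : ℕ) :
    (cfX ω n)⁻¹ = cfA ω (n + 1) + cfX ω (n + 1) := by
  have h : 0 ≤ ⌊(cfX ω n)⁻¹⌋ := Int.floor_nonneg.2 (inv_pos.2 (cfX_mem_Ioo hω h0 h1 n).1).le
  have hA : ((cfA ω (n + 1) : ℕ) : ℝ) = (⌊(cfX ω n)⁻¹⌋ : ℝ) := by
    exact_mod_cast congrArg (Int.cast : ℤ → ℝ) (Int.toNat_of_nonneg h)
  rw [hA]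
  exact (Int.floor_add_fract _).symm

theorem cfX_mul_eq_one {ω : ℝ} (hω : Irrational ω) (h0 : 0 < ω) (h1 : ω < 1) (n : ℕ) :
    cfX ω n * (cfA ω (n + 1) + cfX ω (n + 1)) = 1 := by
  rw [← cfX_inv_eq hω h0 h1]
  exact mul_inv_cancel₀ (cfX_mem_Ioo hω h0 h1 n).1.ne'

theorem one_le_cfA {ω : ℝ} (hω : Irrational ω) (h0 : 0 < ω) (h1 : ω < 1) (n : ℕ) :
    1 ≤ cfA ω (n + 1) := by
  have h2 := cfX_inv_eq hω h0 h1 n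
  have h3 := cfX_mem_Ioo hω h0 h1 n
  have h4 := cfX_mem_Ioo hω h0 h1 (n + 1)
  have h5 : 1 < (cfX ω n)⁻¹ := (one_lt_inv₀ h3.1).2 h3.2
  have h6 : (0 : ℝ) < cfA ω (n + 1) := by linarith
  exact_mod_cast h6

theorem one_le_cfQ {ω : ℝ} (hω : Irrational ω) (h0 : 0 < ω) (h1 : ω < 1) (n : ℕ) :
    1 ≤ cfQ ω n := by
  induction n using Nat.twoStepInduction with
  | zero => exact le_rfl
  | one => exact one_le_cfA hω h0 h1 0
  | more n ih _ => exact ih.trans (Nat.le_add_left _ _)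

theorem cfQ_le_cfQ_succ {ω : ℝ} (hω : Irrational ω) (h0 : 0 < ω) (h1 : ω < 1) (n : ℕ) :
    cfQ ω n ≤ cfQ ω (n + 1) := by
  cases n with
  | zero => exact one_le_cfA hω h0 h1 0
  | succ n =>
    exact (Nat.le_mul_of_pos_left _ (one_le_cfA hω h0 h1 (n + 1))).trans (Nat.le_add_right _ _)

theorem cfA_le_cfQ {ω : ℝ} (hω : Irrational ω) (h0 : 0 < ω) (h1 : ω < 1) (n : ℕ) :
    cfA ω (n + 1) ≤ cfQ ω (n + 1) := by
  cases n with
  | zero => exact le_rfl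
  | succ n =>
    exact (Nat.le_mul_of_pos_right _ (one_le_cfQ hω h0 h1 (n + 1))).trans (Nat.le_add_right _ _)

theorem cfQ_mul_sub_cfP {ω : ℝ} (hω : Irrational ω) (h0 : 0 < ω) (h1 : ω < 1) (n : ℕ) :
    (cfQ ω n : ℝ) * ω - cfP ω n = (-1) ^ n * ∏ i ∈ Finset.range (n + 1), cfX ω i := by
  induction n using Nat.twoStepInduction with
  | zero => simp [cfQ, cfP, cfX]
  | one =>
    have h := cfX_mul_eq_one hω h0 h1 0
    simp only [cfX] at h
    simp only [cfQ, cfP, Finset.prod_range_succ, Finset.prod_range_zero, cfX]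
    push_cast
    linear_combination h
  | more n ih ih' =>
    have h := cfX_mul_eq_one hω h0 h1 (n + 1)
    rw [Finset.prod_range_succ] at ih'
    rw [Finset.prod_range_succ, Finset.prod_range_succ]
    simp only [cfQ, cfP]
    push_cast
    linear_combination (cfA ω (n + 2) : ℝ) * ih' + ih -
      (-1) ^ n * (∏ i ∈ Finset.range (n + 1), cfX ω i) * h

theorem prod_cfX_mul_eq_one {ω : ℝ} (hω : Irrational ω) (h0 : 0 < ω) (h1 : ω < 1) (n : ℕ) :
    (∏ i ∈ Finset.range (n + 1), cfX ω i) * (cfQ ω (n + 1) + cfX ω (n + 1) * cfQ ω n) = 1 := by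
  induction n with
  | zero => simpa [cfQ] using cfX_mul_eq_one hω h0 h1 0
  | succ n ih =>
    have h := cfX_mul_eq_one hω h0 h1 (n + 1)
    rw [Finset.prod_range_succ]
    simp only [cfQ]
    push_cast
    linear_combination ih + (∏ i ∈ Finset.range (n + 1), cfX ω i) * (cfQ ω (n + 1) : ℝ) * h

theorem abs_cfQ_mul_sub_cfP_bounds {ω : ℝ} (hω : Irrational ω) (h0 : 0 < ω) (h1 : ω < 1)
    (n : ℕ) : 0 < |(cfQ ω n : ℝ) * ω - cfP ω n| ∧
      |(cfQ ω n : ℝ) * ω - cfP ω n| * cfQ ω (n + 1) ≤ 1 ∧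
      1 ≤ |(cfQ ω n : ℝ) * ω - cfP ω n| * (2 * cfQ ω (n + 1)) := by
  have hpos : 0 < ∏ i ∈ Finset.range (n + 1), cfX ω i :=
    Finset.prod_pos fun i _ => (cfX_mem_Ioo hω h0 h1 i).1
  have h := prod_cfX_mul_eq_one hω h0 h1 n
  have hx := cfX_mem_Ioo hω h0 h1 (n + 1)
  have hq : (cfQ ω n : ℝ) ≤ cfQ ω (n + 1) := by exact_mod_cast cfQ_le_cfQ_succ hω h0 h1 n
  have hq0 : (0 : ℝ) ≤ cfQ ω n := Nat.cast_nonneg _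
  rw [cfQ_mul_sub_cfP hω h0 h1, abs_mul, abs_pow, abs_neg, abs_one, one_pow, one_mul,
    abs_of_pos hpos]
  refine ⟨hpos, ?_, ?_⟩
  · rw [← h]
    gcongr
    nlinarith
  · rw [← h]
    gcongr
    nlinarith

theorem aStar_sq_le {ω : ℝ} {k : ℕ} (hA : 1 ≤ cfA ω (k + 1)) :
    aStar ω k ^ 2 ≤ cfA ω (k + 1) := by
  have hle : (aStar ω k : ℝ) ≤ √(((cfA ω (k + 1) : ℝ) + 2) / 2) := by
    have h : aStar ω k ≤ (⌊√(((cfA ω (k + 1) : ℝ) + 2) / 2)⌋).toNat := by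
      unfold aStar
      split_ifs <;> omega
    refine (Nat.cast_le.2 h).trans ?_
    rw [Int.floor_toNat]
    exact Nat.floor_le (Real.sqrt_nonneg _)
  have hsq := (Real.le_sqrt (Nat.cast_nonneg _) (by positivity)).1 hle
  have hnat : 2 * aStar ω k ^ 2 ≤ cfA ω (k + 1) + 2 := by
    have : 2 * (aStar ω k : ℝ) ^ 2 ≤ cfA ω (k + 1) + 2 := by linarith
    exact_mod_cast this
  omega

theorem sum_exp_div_le (s : ℝ) (hs : 0 ≤ s) (n : ℕ) :
    ∑ a ∈ Finset.Icc 1 n, exp (-a * s) / a ≤ exp (-s) + exp (-2 * s) * log n := by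
  induction n with
  | zero => simpa using (exp_pos _).le
  | succ n ih =>
    rcases Nat.eq_zero_or_pos n with rfl | hn
    · simp
    rw [Finset.sum_Icc_succ_top (by omega)]
    have hn' : (1 : ℝ) ≤ n := by exact_mod_cast hn
    have hlog : 1 / ((n : ℝ) + 1) ≤ log (n + 1) - log n := by
      rw [← log_div (by positivity) (by positivity)]
      refine le_trans (le_of_eq ?_) (one_sub_inv_le_log_of_pos (by positivity))
      field_simp
      ring
    have hexp : exp (-(n + 1 : ℝ) * s) ≤ exp (-2 * s) := exp_le_exp.2 (by nlinarith)
    have hstep : exp (-(n + 1 : ℝ) * s) / (n + 1) ≤ exp (-2 * s) * (log (n + 1) - log n) := by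
      rw [div_eq_mul_one_div]
      exact mul_le_mul hexp hlog (by positivity) (exp_pos _).le
    push_cast
    linarith

/-- The summand of the Brjuno sum at the index `(q, p)`. -/
noncomputable def brjunoTerm (ω δ : ℝ) (x : ℤ × ℤ) : ℝ :=
  exp (-((|x.1| + |x.2| : ℤ) : ℝ) * δ) / |(x.1 : ℝ) * ω - (x.2 : ℝ)|

theorem brjunoTerm_neg (ω δ : ℝ) (x : ℤ × ℤ) : brjunoTerm ω δ (-x) = brjunoTerm ω δ x := by
  unfold brjunoTerm
  simp only [Prod.fst_neg, Prod.snd_neg, abs_neg, Int.cast_neg]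
  rw [← abs_neg ((x.1 : ℝ) * ω - x.2)]
  congr 2
  ring

theorem brjunoTerm_nonneg (ω δ : ℝ) (x : ℤ × ℤ) : 0 ≤ brjunoTerm ω δ x :=
  div_nonneg (exp_pos _).le (abs_nonneg _)

theorem brjunoTerm_mul_convergent_le {ω δ : ℝ} (hω : Irrational ω) (h0 : 0 < ω) (h1 : ω < 1)
    (hδ : 0 < δ) {k a : ℕ} (ha : 1 ≤ a) (ha' : a ≤ cfA ω (k + 1)) :
    brjunoTerm ω δ ((a : ℤ) * (cfQ ω k : ℤ), (a : ℤ) * (cfP ω k : ℤ)) ≤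
      2 * exp δ * cfQ ω (k + 1) * (exp (-a * (cfQ ω k * ((1 + ω) * δ))) / a) := by
  obtain ⟨hb, hb1, hb2⟩ := abs_cfQ_mul_sub_cfP_bounds hω h0 h1 k
  have hb3 := le_abs_self ((cfQ ω k : ℝ) * ω - cfP ω k)
  have haQ : (a : ℝ) ≤ cfQ ω (k + 1) := by
    exact_mod_cast ha'.trans (cfA_le_cfQ hω h0 h1 k)
  have ha0 : (0 : ℝ) < a := by exact_mod_cast ha
  have habs : |((a * cfQ ω k : ℝ)) * ω - a * cfP ω k| = a * |(cfQ ω k : ℝ) * ω - cfP ω k| := by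
    rw [← abs_of_pos ha0, ← abs_mul, abs_of_pos ha0]
    congr 1
    ring
  unfold brjunoTerm
  push_cast
  rw [habs, abs_of_nonneg (by positivity : (0 : ℝ) ≤ a * cfQ ω k),
    abs_of_nonneg (by positivity : (0 : ℝ) ≤ a * cfP ω k)]
  set b := |(cfQ ω k : ℝ) * ω - cfP ω k|
  have hab : (a : ℝ) * b ≤ 1 := by nlinarith
  have hexp : exp (-(a * cfQ ω k + a * cfP ω k : ℝ) * δ) ≤
      exp δ * exp (-a * (cfQ ω k * ((1 + ω) * δ))) := by
    rw [← exp_add]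
    refine exp_le_exp.2 ?_
    have h2 : (a : ℝ) * (cfQ ω k * ω - cfP ω k) ≤ 1 :=
      (mul_le_mul_of_nonneg_left hb3 ha0.le).trans hab
    linarith [mul_le_mul_of_nonneg_right h2 hδ.le]
  rw [div_le_iff₀ (by positivity)]
  calc _ ≤ exp δ * exp (-a * (cfQ ω k * ((1 + ω) * δ))) * 1 := by rwa [mul_one]
    _ ≤ exp δ * exp (-a * (cfQ ω k * ((1 + ω) * δ))) * (b * (2 * cfQ ω (k + 1))) := by gcongr
    _ = _ := by field_simp

theorem sum_brjunoTerm_le {ω δ : ℝ} (hω : Irrational ω) (h0 : 0 < ω) (h1 : ω < 1)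
    (hδ : 0 < δ) (k : ℕ) :
    ∑ a ∈ Finset.Icc 1 (aStar ω k),
        brjunoTerm ω δ ((a : ℤ) * (cfQ ω k : ℤ), (a : ℤ) * (cfP ω k : ℤ)) ≤
      2 * exp δ * (exp (-(cfQ ω k : ℝ) * ((1 + ω) * δ)) * cfQ ω (k + 1)) +
        exp δ * (exp (-2 * (cfQ ω k : ℝ) * ((1 + ω) * δ)) * cfQ ω (k + 1) *
          log (cfA ω (k + 1))) := by
  have hA := one_le_cfA hω h0 h1 k
  have hsq := aStar_sq_le hA
  have hlog : 2 * log (aStar ω k) ≤ log (cfA ω (k + 1)) := by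
    rcases Nat.eq_zero_or_pos (aStar ω k) with h | h
    · simpa [h] using log_nonneg (by exact_mod_cast hA)
    · rw [show 2 * log (aStar ω k : ℝ) = log ((aStar ω k : ℝ) ^ 2) by simp]
      exact log_le_log (by positivity) (by exact_mod_cast hsq)
  calc _ ≤ ∑ a ∈ Finset.Icc 1 (aStar ω k),
        2 * exp δ * cfQ ω (k + 1) * (exp (-a * (cfQ ω k * ((1 + ω) * δ))) / a) := by
        refine Finset.sum_le_sum fun a ha => ?_
        obtain ⟨ha1, ha2⟩ := Finset.mem_Icc.1 ha
        exact brjunoTerm_mul_convergent_le hω h0 h1 hδ ha1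
          ((ha2.trans (Nat.le_self_pow two_ne_zero _)).trans hsq)
    _ ≤ 2 * exp δ * cfQ ω (k + 1) * (exp (-(cfQ ω k * ((1 + ω) * δ))) +
        exp (-2 * (cfQ ω k * ((1 + ω) * δ))) * log (aStar ω k)) := by
        rw [← Finset.mul_sum]
        gcongr
        exact sum_exp_div_le _ (by positivity) _
    _ = 2 * exp δ * (exp (-(cfQ ω k : ℝ) * ((1 + ω) * δ)) * cfQ ω (k + 1)) +
        exp δ * (exp (-2 * (cfQ ω k : ℝ) * ((1 + ω) * δ)) * cfQ ω (k + 1) *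
          (2 * log (aStar ω k))) := by
        rw [neg_mul (cfQ ω k : ℝ), mul_assoc (-2 : ℝ)]
        ring
    _ ≤ _ := by gcongr

theorem tsum_brjunoPlus_le {ω : ℝ} (f : ℤ × ℤ → ℝ≥0∞) :
    ∑' x : BrjunoPlus ω, f x ≤ ∑' k : ℕ, ∑ a ∈ Finset.Icc 1 (aStar ω k),
      f ((a : ℤ) * (cfQ ω k : ℤ), (a : ℤ) * (cfP ω k : ℤ)) := by
  have hset : BrjunoPlus ω = ⋃ k : ℕ, ⋃ a ∈ Finset.Icc 1 (aStar ω k),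
      {((a : ℤ) * (cfQ ω k : ℤ), (a : ℤ) * (cfP ω k : ℤ))} := by
    ext ⟨q, p⟩
    simp only [BrjunoPlus, Set.mem_ofPred_eq, Set.mem_iUnion, Finset.mem_Icc,
      Set.mem_singleton_iff, Prod.mk.injEq, exists_prop, and_assoc]
  rw [hset]
  refine (ENNReal.tsum_iUnion_le_tsum f _).trans (ENNReal.tsum_le_tsum fun k => ?_)
  refine (ENNReal.tsum_biUnion_le f _ _).trans (le_of_eq ?_)
  exact Finset.sum_congr rfl fun a _ => tsum_singleton _ f

theorem tsum_brjunoSet_le {ω : ℝ} (f : ℤ × ℤ → ℝ≥0∞) (hf : ∀ x, f (-x) = f x) :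
    ∑' x : BrjunoSet ω, f x ≤ 2 * ∑' x : BrjunoPlus ω, f x := by
  have hneg : ∑' x : {qp : ℤ × ℤ | -qp ∈ BrjunoPlus ω}, f x = ∑' x : BrjunoPlus ω, f x := by
    let e : {qp : ℤ × ℤ | -qp ∈ BrjunoPlus ω} ≃ BrjunoPlus ω :=
      (Equiv.neg (ℤ × ℤ)).subtypeEquiv fun _ => Iff.rfl
    rw [← e.tsum_eq fun x : BrjunoPlus ω => f x]
    exact tsum_congr fun x => (hf x).symm
  rw [two_mul]
  nth_rewrite 2 [← hneg]
  exact ENNReal.tsum_union_le f _ _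

/-- for irrational `ω ∈ (0,1)`, `δ > 0` and `Δ = (1+ω)δ`, as an inequality in
`[0,∞]`, the sum of `e^{-(|q|+|p|)δ}/|qω-p|` over the Brjuno indices is at most
`2 (2 e^δ Σ_{k=0}^∞ e^{-q_k Δ} q_{k+1} + e^δ Σ_{k=0}^∞ e^{-2 q_k Δ} q_{k+1} log a_{k+1})`. -/
theorem brjuno_sum_bound (ω : ℝ) (hirr : Irrational ω) (hω0 : 0 < ω) (hω1 : ω < 1)
    (δ : ℝ) (hδ : 0 < δ) :
    (∑' x : (BrjunoSet ω),
        ENNReal.ofReal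
          (Real.exp (-((|(x : ℤ × ℤ).1| + |(x : ℤ × ℤ).2| : ℤ) : ℝ) * δ) /
            |((x : ℤ × ℤ).1 : ℝ) * ω - ((x : ℤ × ℤ).2 : ℝ)|)) ≤
      2 * (2 * ENNReal.ofReal (Real.exp δ) *
            (∑' k : ℕ, ENNReal.ofReal
              (Real.exp (-(cfQ ω k : ℝ) * ((1 + ω) * δ)) * (cfQ ω (k + 1) : ℝ)))
          + ENNReal.ofReal (Real.exp δ) *
            (∑' k : ℕ, ENNReal.ofReal
              (Real.exp (-2 * (cfQ ω k : ℝ) * ((1 + ω) * δ)) * (cfQ ω (k + 1) : ℝ) *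
                Real.log (cfA ω (k + 1) : ℝ)))) := by
  refine (tsum_brjunoSet_le (fun x => ENNReal.ofReal (brjunoTerm ω δ x))
    fun x => by rw [brjunoTerm_neg]).trans ?_
  gcongr
  refine (tsum_brjunoPlus_le fun x => ENNReal.ofReal (brjunoTerm ω δ x)).trans ?_
  rw [← ENNReal.tsum_mul_left, ← ENNReal.tsum_mul_left, ← ENNReal.tsum_add]
  refine ENNReal.tsum_le_tsum fun k => ?_
  rw [← ENNReal.ofReal_sum_of_nonneg fun _ _ => brjunoTerm_nonneg _ _ _]
  have hlog : 0 ≤ Real.log (cfA ω (k + 1)) :=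
    Real.log_nonneg (by exact_mod_cast one_le_cfA hirr hω0 hω1 k)
  rw [← ENNReal.ofReal_ofNat 2, ← ENNReal.ofReal_mul (by positivity),
    ← ENNReal.ofReal_mul (by positivity), ← ENNReal.ofReal_mul (by positivity),
    ← ENNReal.ofReal_add (by positivity) (by positivity)]
  exact ENNReal.ofReal_le_ofReal (sum_brjunoTerm_le hirr hω0 hω1 hδ k)
end

section
/- Let ω ∈ (0,1) be irrational, τ ≥ 1, and Δ ∈ (0, min(τ^{−1}, τ e^{−1})]. Then Σ_{n=1}^∞ e^{−q_n Δ} q_n^τ log q_n ≤ ((τ e^{−1})^τ / log φ) · Δ^{−τ} · ( log²(Δ^{−1}) + A log(Δ^{−1}) + B ), where A = log(3φ(τ+1)²) + Γ_Eul(τ)/(2(τ e^{−1})^τ) and B = log(3φ(τ+1)) · log(τ+1) + Λ(τ)/(τ e^{−1})^τ. -/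
open Real
open scoped ENNReal

noncomputable section

/-- The golden ratio `φ = (1+√5)/2`. -/
def goldenφ : ℝ := (1 + Real.sqrt 5) / 2

/-- `Λ(s) = ∫_0^∞ e^{-y} y^{s-1} |log y| dy`. -/
def LambdaInt (s : ℝ) : ℝ := ∫ y in Set.Ioi (0 : ℝ), Real.exp (-y) * y ^ (s - 1) * |Real.log y|

end

/-! ### Growth of the convergent denominators -/

theorem cfX_spec {ω : ℝ} (hirr : Irrational ω) (h0 : 0 < ω) (h1 : ω < 1) (n : ℕ) :
    Irrational (cfX ω n) ∧ 0 < cfX ω n ∧ cfX ω n < 1 := by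
  induction n with
  | zero => exact ⟨hirr, h0, h1⟩
  | succ n ih =>
    have h : Irrational (cfX ω (n + 1)) := ih.1.inv.sub_intCast _
    exact ⟨h, lt_of_le_of_ne (Int.fract_nonneg _) h.ne_zero.symm, Int.fract_lt_one _⟩

theorem one_le_cfA_succ {ω : ℝ} (hirr : Irrational ω) (h0 : 0 < ω) (h1 : ω < 1) (n : ℕ) :
    1 ≤ cfA ω (n + 1) := by
  obtain ⟨-, hp, hl⟩ := cfX_spec hirr h0 h1 n
  have h : (1 : ℤ) ≤ ⌊(cfX ω n)⁻¹⌋ := by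
    rw [Int.le_floor]
    exact_mod_cast (one_lt_inv₀ hp).2 hl |>.le
  simp only [cfA]
  omega

theorem cfQ_add_le {ω : ℝ} (hirr : Irrational ω) (h0 : 0 < ω) (h1 : ω < 1) (n : ℕ) :
    cfQ ω (n + 1) + cfQ ω n ≤ cfQ ω (n + 2) := by
  simp only [cfQ]
  nlinarith [one_le_cfA_succ hirr h0 h1 (n + 1)]

theorem goldenφ_pow_le_cfQ {ω : ℝ} (hirr : Irrational ω) (h0 : 0 < ω) (h1 : ω < 1) (n : ℕ) :
    goldenφ ^ n ≤ (cfQ ω (n + 1) : ℝ) := by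
  have hstep : ∀ m, (cfQ ω (m + 1) : ℝ) + cfQ ω m ≤ cfQ ω (m + 2) := fun m => by
    exact_mod_cast cfQ_add_le hirr h0 h1 m
  have hq0 : (cfQ ω 0 : ℝ) = 1 := by simp [cfQ]
  have hq1 : (1 : ℝ) ≤ cfQ ω 1 := by exact_mod_cast one_le_cfA_succ hirr h0 h1 0
  have hφ : goldenφ < 2 := Real.goldenRatio_lt_two
  have hsq : goldenφ ^ 2 = goldenφ + 1 := Real.goldenRatio_sq
  induction n using Nat.twoStepInduction with
  | zero => simpa using hq1
  | one => linarith [hstep 0]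
  | more n ih1 ih2 =>
    have h := hstep (n + 1)
    have e : goldenφ ^ (n + 2) = goldenφ ^ (n + 1) + goldenφ ^ n := by
      rw [pow_add, hsq]; ring
    linarith

/-! ### Pointwise bounds on `e^{-y} y^τ` -/

theorem exp_neg_mul_rpow_le {τ y : ℝ} (hτ : 0 < τ) (hy : 0 < y) :
    Real.exp (-y) * y ^ τ ≤ (τ * Real.exp (-1)) ^ τ := by
  rw [Real.rpow_def_of_pos hy, Real.rpow_def_of_pos (by positivity), ← Real.exp_add,
    Real.log_mul hτ.ne' (Real.exp_pos _).ne', Real.log_exp]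
  apply Real.exp_le_exp.2
  have h := Real.log_le_sub_one_of_pos (div_pos hy hτ)
  rw [Real.log_div hy.ne' hτ.ne'] at h
  have h2 := mul_le_mul_of_nonneg_left h hτ.le
  have e : τ * (y / τ - 1) = y - τ := by field_simp
  nlinarith

theorem exp_neg_mul_rpow_mul_log_anti {τ L a b : ℝ} (ha : τ + 1 ≤ a) (ha0 : 0 < a)
    (hab : a ≤ b) (hL : 1 ≤ Real.log a + L) :
    Real.exp (-b) * b ^ τ * (Real.log b + L) ≤ Real.exp (-a) * a ^ τ * (Real.log a + L) := by
  have hb0 : 0 < b := ha0.trans_le hab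
  obtain ⟨s, hs⟩ : ∃ s, s = Real.log b - Real.log a := ⟨_, rfl⟩
  have hlb : Real.log b = Real.log a + s := by linarith
  have hs0 : 0 ≤ s := by linarith [Real.log_le_log ha0 hab]
  have hb : b = a * Real.exp s := by
    rw [hs, Real.exp_sub, Real.exp_log ha0, Real.exp_log hb0]; field_simp
  have h1 : Real.log b + L ≤ (Real.log a + L) * Real.exp s := by
    have := Real.add_one_le_exp s
    rw [hlb]
    nlinarith
  have h2 : Real.exp (-b) * b ^ τ * Real.exp s ≤ Real.exp (-a) * a ^ τ := by
    rw [Real.rpow_def_of_pos hb0, Real.rpow_def_of_pos ha0, ← Real.exp_add, ← Real.exp_add,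
      ← Real.exp_add]
    apply Real.exp_le_exp.2
    have h3 : a * (s + 1) ≤ b := by
      rw [hb]; exact mul_le_mul_of_nonneg_left (Real.add_one_le_exp s) ha0.le
    rw [hlb]
    nlinarith
  calc _ ≤ Real.exp (-b) * b ^ τ * ((Real.log a + L) * Real.exp s) := by gcongr
    _ = Real.exp (-b) * b ^ τ * Real.exp s * (Real.log a + L) := by ring
    _ ≤ _ := by gcongr

/-! ### Gamma-type integrals -/

theorem integrableOn_gamma_mul_abs_log {τ : ℝ} (hτ : 1 ≤ τ) :
    MeasureTheory.IntegrableOn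
      (fun y : ℝ => Real.exp (-y) * y ^ (τ - 1) * |Real.log y|) (Set.Ioi 0) := by
  have i1 := Real.GammaIntegral_convergent (s := τ + 1) (by linarith)
  have i2 := (Real.GammaIntegral_convergent (s := τ - 1 / 2) (by linarith)).const_mul 2
  refine (i1.add i2).mono' (by fun_prop) ?_
  refine (MeasureTheory.ae_restrict_iff' measurableSet_Ioi).2 (Filter.Eventually.of_forall ?_)
  intro y hy
  have hy0 : (0 : ℝ) < y := hy
  have e1 : y ^ (τ + 1 - 1) = y ^ (τ - 1) * y := by
    rw [← Real.rpow_add_one hy0.ne']; ring_nf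
  have e2 : y ^ (τ - 1 / 2 - 1) = y ^ (τ - 1) * y ^ (-(1 / 2) : ℝ) := by
    rw [← Real.rpow_add hy0]; ring_nf
  have hlog : |Real.log y| ≤ y + 2 * y ^ (-(1 / 2) : ℝ) := by
    have hp : 0 < y ^ (-(1 / 2) : ℝ) := by positivity
    have h1 := Real.log_le_sub_one_of_pos hy0
    have h2 := Real.log_le_sub_one_of_pos hp
    rw [Real.log_rpow hy0] at h2
    rw [abs_le]
    constructor <;> linarith
  rw [Real.norm_of_nonneg (by positivity)]
  simp only [Pi.add_apply]
  rw [e1, e2]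
  calc _ ≤ Real.exp (-y) * y ^ (τ - 1) * (y + 2 * y ^ (-(1 / 2) : ℝ)) := by gcongr
    _ = _ := by ring

theorem two_mul_log_le_sub_inv {t : ℝ} (ht : 1 ≤ t) : 2 * Real.log t ≤ t - t⁻¹ := by
  have h0 : 0 ≤ Real.log t := Real.log_nonneg ht
  have h := Real.self_le_sinh_iff.2 h0
  rw [Real.sinh_eq, Real.exp_neg, Real.exp_log (by linarith)] at h
  linarith

theorem gamma_reflect_le {τ c x : ℝ} (hτ : τ ≤ c) (hc : 0 < c) (hx : 0 < x)
    (hxc : x ≤ c) :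
    Real.exp (-(c ^ 2 / x)) * (c ^ 2 / x) ^ τ ≤ Real.exp (-x) * x ^ τ := by
  have hy : 0 < c ^ 2 / x := by positivity
  rw [Real.rpow_def_of_pos hy, Real.rpow_def_of_pos hx, ← Real.exp_add, ← Real.exp_add]
  apply Real.exp_le_exp.2
  have h := two_mul_log_le_sub_inv ((one_le_div hx).2 hxc)
  have h0 : 0 ≤ Real.log (c / x) := Real.log_nonneg ((one_le_div hx).2 hxc)
  have e : Real.log (c ^ 2 / x) = Real.log x + 2 * Real.log (c / x) := by
    rw [Real.log_div (by positivity) hx.ne', Real.log_div hc.ne' hx.ne', Real.log_pow]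
    push_cast; ring
  have h2 := mul_le_mul_of_nonneg_left h hc.le
  have e2 : c * (c / x - (c / x)⁻¹) = c ^ 2 / x - x := by field_simp
  rw [e]
  nlinarith

/-- At least half of the mass of the Gamma distribution lies below any `c ≥ τ`. -/
theorem integral_Ioi_gamma_le_half {τ c : ℝ} (hτ : 0 < τ) (hτc : τ ≤ c) :
    ∫ y in Set.Ioi c, Real.exp (-y) * y ^ (τ - 1) ≤ Real.Gamma τ / 2 := by
  have hc : 0 < c := hτ.trans_le hτc
  obtain ⟨h, hh⟩ : ∃ h : ℝ → ℝ, h = fun y => Real.exp (-y) * y ^ (τ - 1) := ⟨_, rfl⟩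
  have hint : MeasureTheory.IntegrableOn h (Set.Ioi 0) := by
    rw [hh]; exact Real.GammaIntegral_convergent hτ
  have hΓ : Real.Gamma τ = ∫ y in Set.Ioi 0, h y := by rw [hh]; exact Real.Gamma_eq_integral hτ
  have hnn : ∀ y, 0 < y → 0 ≤ h y := fun y hy => by rw [hh]; positivity
  obtain ⟨g, hg⟩ : ∃ g : ℝ → ℝ, g = (Set.Ioi c).indicator h := ⟨_, rfl⟩
  have hJ : ∫ y in Set.Ioi c, h y = ∫ y in Set.Ioi 0, g y := by
    rw [hg, MeasureTheory.setIntegral_indicator measurableSet_Ioi,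
      Set.inter_eq_right.2 (Set.Ioi_subset_Ioi hc.le)]
  have hgint : MeasureTheory.IntegrableOn g (Set.Ioi 0) := by
    rw [hg]; exact hint.indicator measurableSet_Ioi
  have hsub : ∫ y in Set.Ioi 0, g y =
      ∫ x in Set.Ioi 0, (c ^ 2) * (x ^ (-2 : ℝ) * g (c ^ 2 / x)) := by
    have e1 := MeasureTheory.integral_comp_rpow_Ioi g (p := -1) (by norm_num)
    have e2 := MeasureTheory.integral_comp_mul_left_Ioi
      (fun x : ℝ => (|(-1 : ℝ)| * x ^ ((-1 : ℝ) - 1)) • g (x ^ (-1 : ℝ))) 0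
      (b := (c ^ 2)⁻¹) (by positivity)
    rw [mul_zero, e1, inv_inv] at e2
    have hc2 : (c ^ 2 : ℝ) ≠ 0 := by positivity
    have e3 : ∫ y in Set.Ioi 0, g y = (c ^ 2)⁻¹ * ((c ^ 2) • ∫ y in Set.Ioi 0, g y) := by
      rw [smul_eq_mul]; field_simp
    rw [e3, ← e2, ← MeasureTheory.integral_const_mul]
    refine MeasureTheory.setIntegral_congr_fun measurableSet_Ioi ?_
    intro x hx
    have hx0 : (0 : ℝ) < x := hx
    simp only [smul_eq_mul, abs_neg, abs_one, one_mul]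
    rw [show ((-1 : ℝ) - 1) = -2 by norm_num, Real.mul_rpow (by positivity) hx0.le,
      Real.rpow_neg_one, mul_inv, inv_inv, ← div_eq_mul_inv,
      Real.rpow_neg (by positivity) 2, Real.rpow_two]
    field_simp
  have hle : ∫ x in Set.Ioi 0, (c ^ 2) * (x ^ (-2 : ℝ) * g (c ^ 2 / x)) ≤
      ∫ x in Set.Ioi 0, (h x - g x) := by
    refine MeasureTheory.integral_mono_of_nonneg ?_ (hint.sub hgint) ?_
    all_goals
      refine (MeasureTheory.ae_restrict_iff' measurableSet_Ioi).2
        (Filter.Eventually.of_forall ?_)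
      intro x hx
      have hx0 : (0 : ℝ) < x := hx
    · have : 0 ≤ g (c ^ 2 / x) := by
        rw [hg]
        exact Set.indicator_nonneg (fun y hy => hnn y (hc.trans hy)) _
      simp only [Pi.zero_apply]
      positivity
    · simp only
      by_cases hxc : c ≤ x
      · have h1 : g (c ^ 2 / x) = 0 := by
          rw [hg]
          refine Set.indicator_of_notMem ?_ _
          simp only [Set.mem_Ioi, not_lt]
          rw [div_le_iff₀ hx0]
          nlinarith
        have h2 : g x ≤ h x := by
          rw [hg]
          exact Set.indicator_le_self' (fun _ _ => hnn x hx0) x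
        rw [h1]
        linarith
      · push Not at hxc
        have h1 : g x = 0 := by
          rw [hg]
          exact Set.indicator_of_notMem (by simpa using hxc.le) _
        have h2 : g (c ^ 2 / x) = h (c ^ 2 / x) := by
          rw [hg]
          refine Set.indicator_of_mem ?_ _
          simp only [Set.mem_Ioi]
          rw [lt_div_iff₀ hx0]
          nlinarith
        rw [h1, h2, sub_zero, hh]
        have hy : 0 < c ^ 2 / x := by positivity
        have h3 := gamma_reflect_le hτc hc hx0 hxc.le
        simp only
        rw [Real.rpow_sub_one hy.ne', Real.rpow_sub_one hx0.ne', Real.rpow_neg hx0.le,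
          Real.rpow_two]
        calc _ = Real.exp (-(c ^ 2 / x)) * (c ^ 2 / x) ^ τ / x := by field_simp
          _ ≤ Real.exp (-x) * x ^ τ / x := by gcongr
          _ = _ := by ring
  rw [MeasureTheory.integral_sub hint hgint, ← hsub, ← hJ, ← hΓ] at hle
  rw [hh] at hle
  linarith

theorem integrableOn_Ioi_gamma_mul_log {τ c : ℝ} (hτ : 1 ≤ τ) (hc : 1 ≤ c) :
    MeasureTheory.IntegrableOn
      (fun y : ℝ => Real.exp (-y) * y ^ (τ - 1) * Real.log y) (Set.Ioi c) := by
  refine ((integrableOn_gamma_mul_abs_log hτ).mono_set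
    (Set.Ioi_subset_Ioi (zero_le_one.trans hc))).congr_fun ?_ measurableSet_Ioi
  intro y hy
  have hy1 : (1 : ℝ) ≤ y := hc.trans (le_of_lt hy)
  simp only [abs_of_nonneg (Real.log_nonneg hy1)]

theorem integrableOn_Ioi_gamma {τ c : ℝ} (hτ : 0 < τ) (hc : 0 ≤ c) :
    MeasureTheory.IntegrableOn (fun y : ℝ => Real.exp (-y) * y ^ (τ - 1)) (Set.Ioi c) :=
  (Real.GammaIntegral_convergent hτ).mono_set (Set.Ioi_subset_Ioi hc)

theorem integral_Ioi_gamma_mul_log_le {τ c : ℝ} (hτ : 1 ≤ τ) (hc : 1 ≤ c) :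
    ∫ y in Set.Ioi c, Real.exp (-y) * y ^ (τ - 1) * Real.log y ≤ LambdaInt τ := by
  have h : ∫ y in Set.Ioi c, Real.exp (-y) * y ^ (τ - 1) * Real.log y =
      ∫ y in Set.Ioi c, Real.exp (-y) * y ^ (τ - 1) * |Real.log y| := by
    refine MeasureTheory.setIntegral_congr_fun measurableSet_Ioi ?_
    intro y hy
    have hy1 : (1 : ℝ) ≤ y := hc.trans (le_of_lt hy)
    simp only [abs_of_nonneg (Real.log_nonneg hy1)]
  rw [h]
  refine MeasureTheory.setIntegral_mono_set (integrableOn_gamma_mul_abs_log hτ) ?_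
    (Set.Ioi_subset_Ioi (zero_le_one.trans hc)).eventuallyLE
  refine (MeasureTheory.ae_restrict_iff' measurableSet_Ioi).2 (Filter.Eventually.of_forall ?_)
  intro y hy
  have hy0 : (0 : ℝ) < y := hy
  simp only [Pi.zero_apply]
  positivity

/-! ### Comparison of geometric sums with integrals -/

/-- A function antitone on `[c, ∞)`, summed along a geometric progression, is bounded by its
integral against `dy / y`. -/
theorem sum_geometric_mul_log_le_integral {G : ℝ → ℝ} {c r : ℝ} (hc : 0 < c) (hr : 1 < r)
    (hanti : AntitoneOn G (Set.Ici c))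
    (hint : MeasureTheory.IntegrableOn (fun y => G y / y) (Set.Ioi c)) (m : ℕ) :
    (∑ j ∈ Finset.range m, G (c * r ^ (j + 1))) * Real.log r ≤
      ∫ y in c..(c * r ^ m), G y / y := by
  have hr0 : 0 < r := by linarith
  have hmono : ∀ j : ℕ, c ≤ c * r ^ j := fun j =>
    le_mul_of_one_le_right hc.le (one_le_pow₀ hr.le)
  have hii : ∀ a b : ℝ, c ≤ a → a ≤ b →
      IntervalIntegrable (fun y => G y / y) MeasureTheory.volume a b := fun a b ha hab => by
    rw [intervalIntegrable_iff_integrableOn_Ioc_of_le hab]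
    exact hint.mono_set (fun y hy => lt_of_le_of_lt ha hy.1)
  induction m with
  | zero => simp
  | succ m ih =>
    have hstep : c * r ^ m ≤ c * r ^ (m + 1) :=
      mul_le_mul_of_nonneg_left (pow_le_pow_right₀ hr.le (Nat.le_succ m)) hc.le
    have hm0 : 0 < c * r ^ m := by positivity
    have hm1 : 0 < c * r ^ (m + 1) := by positivity
    rw [← intervalIntegral.integral_add_adjacent_intervals (hii c (c * r ^ m) le_rfl (hmono m))
      (hii (c * r ^ m) (c * r ^ (m + 1)) (hmono m) hstep), Finset.sum_range_succ, add_mul]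
    refine add_le_add ih ?_
    have e : G (c * r ^ (m + 1)) * Real.log r =
        ∫ y in (c * r ^ m)..(c * r ^ (m + 1)), G (c * r ^ (m + 1)) * (1 / y) := by
      rw [intervalIntegral.integral_const_mul, integral_one_div_of_pos hm0 hm1]
      congr 2
      field_simp
      ring
    rw [e]
    refine intervalIntegral.integral_mono_on hstep ?_ (hii _ _ (hmono m) hstep) ?_
    · refine ContinuousOn.intervalIntegrable ?_
      rw [Set.uIcc_of_le hstep]
      intro y hy
      have : y ≠ 0 := (hm0.trans_le hy.1).ne'
      fun_prop (disch := assumption)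
    · intro y hy
      have hy0 : 0 < y := hm0.trans_le hy.1
      rw [mul_one_div]
      gcongr
      exact hanti ((hmono m).trans hy.1) (hmono (m + 1)) hy.2

theorem sum_geometric_gamma_log_le {τ L c r : ℝ} (hτ : 1 ≤ τ) (hL0 : 0 ≤ L) (hc : τ + 1 ≤ c)
    (hL : 1 ≤ Real.log c + L) (hr : 1 < r) (m : ℕ) :
    (∑ j ∈ Finset.range m, Real.exp (-(c * r ^ (j + 1))) * (c * r ^ (j + 1)) ^ τ *
        (Real.log (c * r ^ (j + 1)) + L)) * Real.log r ≤
      Real.Gamma τ / 2 * L + LambdaInt τ := by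
  have hc0 : 0 < c := by linarith
  have i1 := integrableOn_Ioi_gamma_mul_log (c := c) hτ (by linarith)
  have i2 := (integrableOn_Ioi_gamma (τ := τ) (c := c) (by linarith) hc0.le).mul_const L
  have heq : Set.EqOn (fun y : ℝ => Real.exp (-y) * y ^ (τ - 1) * Real.log y +
      Real.exp (-y) * y ^ (τ - 1) * L)
      (fun y => Real.exp (-y) * y ^ τ * (Real.log y + L) / y) (Set.Ioi c) := by
    intro y hy
    have hy0 : 0 < y := hc0.trans hy
    simp only
    rw [Real.rpow_sub_one hy0.ne']
    field_simp
  have hint : MeasureTheory.IntegrableOn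
      (fun y => Real.exp (-y) * y ^ τ * (Real.log y + L) / y) (Set.Ioi c) :=
    (i1.add i2).congr_fun heq measurableSet_Ioi
  have hcle : c ≤ c * r ^ m := le_mul_of_one_le_right hc0.le (one_le_pow₀ hr.le)
  refine (sum_geometric_mul_log_le_integral
    (G := fun y => Real.exp (-y) * y ^ τ * (Real.log y + L)) hc0 hr ?_ hint m).trans ?_
  · intro a ha b _ hab
    have ha' : c ≤ a := ha
    exact exp_neg_mul_rpow_mul_log_anti (hc.trans ha') (hc0.trans_le ha') hab
      (by linarith [Real.log_le_log hc0 ha'])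
  · rw [intervalIntegral.integral_of_le hcle]
    calc _ ≤ ∫ y in Set.Ioi c, Real.exp (-y) * y ^ τ * (Real.log y + L) / y := by
          refine MeasureTheory.setIntegral_mono_set hint ?_
            (Set.Ioc_subset_Ioi_self).eventuallyLE
          refine (MeasureTheory.ae_restrict_iff' measurableSet_Ioi).2
            (Filter.Eventually.of_forall ?_)
          intro y hy
          have hy0 : 0 < y := hc0.trans hy
          have h1 : 0 ≤ Real.log y + L := by
            linarith [Real.log_le_log hc0 (le_of_lt hy)]
          simp only [Pi.zero_apply]
          positivity
      _ = (∫ y in Set.Ioi c, Real.exp (-y) * y ^ (τ - 1) * Real.log y) +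
            (∫ y in Set.Ioi c, Real.exp (-y) * y ^ (τ - 1)) * L := by
          rw [← MeasureTheory.integral_mul_const, ← MeasureTheory.integral_add i1 i2]
          exact (MeasureTheory.setIntegral_congr_fun measurableSet_Ioi heq).symm
      _ ≤ LambdaInt τ + Real.Gamma τ / 2 * L := by
          gcongr
          · exact integral_Ioi_gamma_mul_log_le hτ (by linarith)
          · exact integral_Ioi_gamma_le_half (by linarith) (by linarith)
      _ = _ := by ring

/-- Partial-sum estimate for `Σ e^{-y_n} y_n^τ (log y_n + L)` along a sequence growing at least
geometrically, where `x` is the threshold past which the summand decreases. -/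
theorem sum_exp_neg_rpow_log_le {τ L r : ℝ} (hτ : 1 ≤ τ) (hL0 : 0 ≤ L)
    (hL : 1 ≤ Real.log (τ + 1) + L) (hr : 1 < r) (hr3 : r < 3) {y : ℕ → ℝ}
    (hy : ∀ n, Real.exp (-L) * r ^ n ≤ y n) (m : ℕ) :
    (∑ n ∈ Finset.range m, Real.exp (-y n) * y n ^ τ * (Real.log (y n) + L)) * Real.log r ≤
      (τ * Real.exp (-1)) ^ τ * ((Real.log (3 * r * (τ + 1)) + L) * (Real.log (τ + 1) + L)) +
        (Real.Gamma τ / 2 * L + LambdaInt τ) := by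
  have hτ1 : 0 < τ + 1 := by linarith
  have hr0 : 0 < r := by linarith
  have hlr : 0 < Real.log r := Real.log_pos hr
  obtain ⟨ℓ, hℓ⟩ : ∃ ℓ, ℓ = Real.log (τ + 1) + L := ⟨_, rfl⟩
  have hexp : Real.exp ℓ = (τ + 1) * Real.exp L := by
    rw [hℓ, Real.exp_add, Real.exp_log hτ1]
  have hy0 : ∀ n, 0 < y n := fun n => lt_of_lt_of_le (by positivity) (hy n)
  have hlog0 : ∀ n, 0 ≤ Real.log (y n) + L := fun n => by
    have h := Real.log_le_log (by positivity)
      ((le_mul_of_one_le_right (Real.exp_pos (-L)).le (one_le_pow₀ hr.le)).trans (hy n))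
    rw [Real.log_exp] at h
    linarith
  have hnn : ∀ n, 0 ≤ Real.exp (-y n) * y n ^ τ * (Real.log (y n) + L) := fun n => by
    have := hy0 n
    have := hlog0 n
    positivity
  have hhead : ∀ n, Real.exp (-y n) * y n ^ τ * (Real.log (y n) + L) ≤
      (τ * Real.exp (-1)) ^ τ * ℓ := fun n => by
    rcases le_total (y n) (τ + 1) with h | h
    · have h1 := exp_neg_mul_rpow_le (τ := τ) (by linarith) (hy0 n)
      have h2 : Real.log (y n) + L ≤ ℓ := by
        rw [hℓ]; linarith [Real.log_le_log (hy0 n) h]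
      exact mul_le_mul h1 h2 (hlog0 n) (by positivity)
    · refine (exp_neg_mul_rpow_mul_log_anti le_rfl hτ1 h hL).trans ?_
      rw [← hℓ]
      exact mul_le_mul_of_nonneg_right (exp_neg_mul_rpow_le (by linarith) hτ1) (by linarith)
  obtain ⟨K, hK⟩ : ∃ K, K = ⌈ℓ / Real.log r⌉₊ := ⟨_, rfl⟩
  have hKlow : ℓ ≤ K * Real.log r := by
    rw [← div_le_iff₀ hlr, hK]; exact Nat.le_ceil _
  have hKup : K * Real.log r ≤ ℓ + Real.log r := by
    have h := (Nat.ceil_lt_add_one (a := ℓ / Real.log r) (div_nonneg (by linarith) hlr.le)).le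
    rw [← hK] at h
    have h2 := mul_le_mul_of_nonneg_right h hlr.le
    rwa [add_mul, div_mul_cancel₀ _ hlr.ne', one_mul] at h2
  have hrK : (τ + 1) * Real.exp L ≤ r ^ K := by
    rw [← hexp, ← Real.exp_log (pow_pos hr0 K), Real.log_pow]
    exact Real.exp_le_exp.2 hKlow
  have htail : ∀ j, (τ + 1) * r ^ (j + 1) ≤ y (K + 1 + j) := fun j => by
    refine le_trans ?_ (hy _)
    calc (τ + 1) * r ^ (j + 1) = Real.exp (-L) * ((τ + 1) * Real.exp L * r ^ (j + 1)) := by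
          rw [Real.exp_neg]; field_simp
      _ ≤ Real.exp (-L) * (r ^ K * r ^ (j + 1)) := by gcongr
      _ = _ := by rw [← pow_add]; ring_nf
  have hcj : ∀ j : ℕ, τ + 1 ≤ (τ + 1) * r ^ (j + 1) := fun j =>
    le_mul_of_one_le_right hτ1.le (one_le_pow₀ hr.le)
  have hsub : ∑ n ∈ Finset.range m, Real.exp (-y n) * y n ^ τ * (Real.log (y n) + L) ≤
      ∑ n ∈ Finset.range (K + 1 + m), Real.exp (-y n) * y n ^ τ * (Real.log (y n) + L) :=
    Finset.sum_le_sum_of_subset_of_nonneg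
      (Finset.range_subset_range.2 (Nat.le_add_left m (K + 1))) fun n _ _ => hnn n
  rw [Finset.sum_range_add] at hsub
  have h1 : ∑ n ∈ Finset.range (K + 1), Real.exp (-y n) * y n ^ τ * (Real.log (y n) + L) ≤
      (K + 1) * ((τ * Real.exp (-1)) ^ τ * ℓ) := by
    refine (Finset.sum_le_card_nsmul _ _ _ fun n _ => hhead n).trans ?_
    simp
  have h2 : ∑ j ∈ Finset.range m, Real.exp (-y (K + 1 + j)) * y (K + 1 + j) ^ τ *
      (Real.log (y (K + 1 + j)) + L) ≤
      ∑ j ∈ Finset.range m, Real.exp (-((τ + 1) * r ^ (j + 1))) * ((τ + 1) * r ^ (j + 1)) ^ τ *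
        (Real.log ((τ + 1) * r ^ (j + 1)) + L) :=
    Finset.sum_le_sum fun j _ => exp_neg_mul_rpow_mul_log_anti (hcj j)
      (hτ1.trans_le (hcj j)) (htail j) (by linarith [Real.log_le_log hτ1 (hcj j)])
  have h3 := sum_geometric_gamma_log_le hτ hL0 le_rfl hL hr m
  have h4 : (K + 1) * Real.log r ≤ Real.log (3 * r * (τ + 1)) + L := by
    rw [Real.log_mul (by positivity) (by positivity), Real.log_mul (by positivity) (by positivity)]
    have := Real.log_le_log hr0 hr3.le
    linarith
  calc _ ≤ ((K + 1) * ((τ * Real.exp (-1)) ^ τ * ℓ) + ∑ j ∈ Finset.range m,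
          Real.exp (-((τ + 1) * r ^ (j + 1))) * ((τ + 1) * r ^ (j + 1)) ^ τ *
            (Real.log ((τ + 1) * r ^ (j + 1)) + L)) * Real.log r :=
        mul_le_mul_of_nonneg_right (by linarith) hlr.le
    _ = (τ * Real.exp (-1)) ^ τ * (((K + 1) * Real.log r) * ℓ) + (∑ j ∈ Finset.range m,
          Real.exp (-((τ + 1) * r ^ (j + 1))) * ((τ + 1) * r ^ (j + 1)) ^ τ *
            (Real.log ((τ + 1) * r ^ (j + 1)) + L)) * Real.log r := by ring
    _ ≤ _ := by
        rw [← hℓ]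
        have : 0 ≤ ℓ := by linarith
        gcongr

/-- for irrational `ω ∈ (0,1)`, `τ ≥ 1` and `Δ ∈ (0, min(τ⁻¹, τe⁻¹)]`:
`Σ_{n=1}^∞ e^{-q_n Δ} q_n^τ log q_n ≤ ((τe⁻¹)^τ/log φ) Δ^{-τ} (log² Δ⁻¹ + A log Δ⁻¹ + B)`. -/
theorem dph2_bound (ω : ℝ) (hirr : Irrational ω) (hω0 : 0 < ω) (hω1 : ω < 1)
    (τ : ℝ) (hτ : 1 ≤ τ)
    (Δ : ℝ) (hΔ0 : 0 < Δ) (hΔ : Δ ≤ min τ⁻¹ (τ * Real.exp (-1))) :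
    (∑' n : ℕ, ENNReal.ofReal
        (Real.exp (-(cfQ ω (n + 1) : ℝ) * Δ) * (cfQ ω (n + 1) : ℝ) ^ τ *
          Real.log (cfQ ω (n + 1) : ℝ))) ≤
      ENNReal.ofReal
        ((τ * Real.exp (-1)) ^ τ / Real.log goldenφ * Δ ^ (-τ) *
          ((Real.log Δ⁻¹) ^ 2
            + (Real.log (3 * goldenφ * (τ + 1) ^ 2) +
                Real.Gamma τ / (2 * (τ * Real.exp (-1)) ^ τ)) * Real.log Δ⁻¹
            + (Real.log (3 * goldenφ * (τ + 1)) * Real.log (τ + 1) +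
                LambdaInt τ / (τ * Real.exp (-1)) ^ τ))) := by
  have hφ1 : 1 < goldenφ := Real.one_lt_goldenRatio
  have hφ3 : goldenφ < 3 := Real.goldenRatio_lt_two.trans (by norm_num)
  have hlφ : 0 < Real.log goldenφ := Real.log_pos hφ1
  have hτ0 : 0 < τ := by linarith
  have hL0 : 0 ≤ Real.log Δ⁻¹ := by
    refine Real.log_nonneg ((one_le_inv₀ hΔ0).2 ?_)
    exact (hΔ.trans (min_le_left _ _)).trans (inv_le_one_of_one_le₀ hτ)
  have hexpL : Real.exp (-Real.log Δ⁻¹) = Δ := by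
    rw [Real.log_inv, neg_neg, Real.exp_log hΔ0]
  have hL1 : 1 ≤ Real.log (τ + 1) + Real.log Δ⁻¹ := by
    have h := Real.log_le_log hΔ0 (hΔ.trans (min_le_right _ _))
    rw [Real.log_mul hτ0.ne' (Real.exp_pos _).ne', Real.log_exp] at h
    rw [Real.log_inv]
    linarith [Real.log_le_log hτ0 (by linarith : τ ≤ τ + 1)]
  have hq := goldenφ_pow_le_cfQ hirr hω0 hω1
  have hq1 : ∀ n, (1 : ℝ) ≤ cfQ ω (n + 1) := fun n => (one_le_pow₀ hφ1.le).trans (hq n)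
  have hy : ∀ n, Real.exp (-Real.log Δ⁻¹) * goldenφ ^ n ≤ (cfQ ω (n + 1) : ℝ) * Δ := fun n => by
    rw [hexpL, mul_comm]
    exact mul_le_mul_of_nonneg_right (hq n) hΔ0.le
  have hterm : ∀ n, Real.exp (-(cfQ ω (n + 1) : ℝ) * Δ) * (cfQ ω (n + 1) : ℝ) ^ τ *
      Real.log (cfQ ω (n + 1) : ℝ) = Δ ^ (-τ) * (Real.exp (-((cfQ ω (n + 1) : ℝ) * Δ)) *
        ((cfQ ω (n + 1) : ℝ) * Δ) ^ τ *
          (Real.log ((cfQ ω (n + 1) : ℝ) * Δ) + Real.log Δ⁻¹)) := fun n => by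
    have h0 : (0 : ℝ) < cfQ ω (n + 1) := one_pos.trans_le (hq1 n)
    have hd : 0 < Δ ^ τ := by positivity
    rw [Real.log_mul h0.ne' hΔ0.ne', Real.log_inv, Real.mul_rpow h0.le hΔ0.le,
      Real.rpow_neg hΔ0.le, neg_mul]
    field_simp
    ring
  refine ENNReal.tsum_le_of_sum_range_le fun m => ?_
  rw [← ENNReal.ofReal_sum_of_nonneg fun n _ => mul_nonneg (by positivity)
    (Real.log_nonneg (hq1 n))]
  refine ENNReal.ofReal_le_ofReal ?_
  simp only [hterm]
  rw [← Finset.mul_sum]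
  have hmain := sum_exp_neg_rpow_log_le hτ hL0 hL1 hφ1 hφ3 hy m
  rw [← le_div_iff₀ hlφ] at hmain
  refine (mul_le_mul_of_nonneg_left hmain (by positivity : 0 ≤ Δ ^ (-τ))).trans (le_of_eq ?_)
  have hM : 0 < (τ * Real.exp (-1)) ^ τ := by positivity
  have hlog : Real.log (3 * goldenφ * (τ + 1) ^ 2) =
      Real.log (3 * goldenφ * (τ + 1)) + Real.log (τ + 1) := by
    rw [← Real.log_mul (by positivity) (by positivity)]
    ring_nf
  rw [hlog]
  generalize (τ * Real.exp (-1)) ^ τ = M at hM ⊢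
  field_simp
  ring
end
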